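/- Let k be a positive integer and let 0 ≤ λ₁ ≤ λ₂ ≤ ⋯ ≤ λ_k ≤ λ_{k+1} be real numbers. Then ( ∑_{i=1}^{k} (λ_{k+1}−λ_i)² λ_i^{1/2} ) · ( ∑_{i=1}^{k} (λ_{k+1}−λ_i) λ_i^{1/2} ) ≤ ( ∑_{i=1}^{k} (λ_{k+1}−λ_i)² ) · ( ∑_{i=1}^{k} (λ_{k+1}−λ_i) λ_i ). -/

import Mathlib

/-- Weighted Chebyshev-type inequality: the difference of the two sides is half the double sum of
`(c - s i ^ 2) * (c - s j ^ 2) * (c + s i * s j) * (s j - s i) ^ 2`. -/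
theorem Finset.sum_sq_mul_sum_le_of_sq_le {ι : Type*} (t : Finset ι) (s : ι → ℝ) (c : ℝ)
    (hs : ∀ i ∈ t, 0 ≤ s i) (hc : ∀ i ∈ t, s i ^ 2 ≤ c) :
    (∑ i ∈ t, (c - s i ^ 2) ^ 2 * s i) * (∑ i ∈ t, (c - s i ^ 2) * s i) ≤
      (∑ i ∈ t, (c - s i ^ 2) ^ 2) * (∑ i ∈ t, (c - s i ^ 2) * s i ^ 2) := by
  set f : ι → ι → ℝ := fun i j =>
    (c - s i ^ 2) ^ 2 * ((c - s j ^ 2) * s j ^ 2) -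
      (c - s i ^ 2) ^ 2 * s i * ((c - s j ^ 2) * s j) with hf
  have hdiff : (∑ i ∈ t, (c - s i ^ 2) ^ 2) * (∑ i ∈ t, (c - s i ^ 2) * s i ^ 2) -
      (∑ i ∈ t, (c - s i ^ 2) ^ 2 * s i) * (∑ i ∈ t, (c - s i ^ 2) * s i) =
      ∑ i ∈ t, ∑ j ∈ t, f i j := by
    simp only [hf, Finset.sum_mul_sum, Finset.sum_sub_distrib]
  have hsymm : ∑ i ∈ t, ∑ j ∈ t, f i j = ∑ i ∈ t, ∑ j ∈ t, f j i := Finset.sum_comm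
  have hnonneg : 0 ≤ ∑ i ∈ t, ∑ j ∈ t, (f i j + f j i) := by
    refine Finset.sum_nonneg fun i hi => Finset.sum_nonneg fun j hj => ?_
    have hpair : f i j + f j i =
        (c - s i ^ 2) * (c - s j ^ 2) * (c + s i * s j) * (s j - s i) ^ 2 := by
      simp only [hf]
      ring
    have hi' := sub_nonneg.2 (hc i hi)
    have hj' := sub_nonneg.2 (hc j hj)
    have hc0 : 0 ≤ c := (sq_nonneg _).trans (hc i hi)
    have hsi := hs i hi
    have hsj := hs j hj
    rw [hpair]
    positivity
  simp only [Finset.sum_add_distrib] at hnonneg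
  linarith


/-- Let `k` be a positive integer and `0 ≤ λ₁ ≤ λ₂ ≤ ⋯ ≤ λ_k ≤ λ_{k+1}`
be real numbers.  Then
`(∑_{i=1}^k (λ_{k+1}-λ_i)² λ_i^{1/2}) · (∑_{i=1}^k (λ_{k+1}-λ_i) λ_i^{1/2})
  ≤ (∑_{i=1}^k (λ_{k+1}-λ_i)²) · (∑_{i=1}^k (λ_{k+1}-λ_i) λ_i)`. -/
theorem chebyshev_type_sqrt_inequality
    (k : ℕ) (hk : 0 < k) (lam : ℕ → ℝ)
    (h0 : 0 ≤ lam 1)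
    (hmono : ∀ i j, 1 ≤ i → i ≤ j → j ≤ k + 1 → lam i ≤ lam j) :
    (∑ i ∈ Finset.Icc 1 k, (lam (k + 1) - lam i) ^ 2 * Real.sqrt (lam i)) *
      (∑ i ∈ Finset.Icc 1 k, (lam (k + 1) - lam i) * Real.sqrt (lam i)) ≤
    (∑ i ∈ Finset.Icc 1 k, (lam (k + 1) - lam i) ^ 2) *
      (∑ i ∈ Finset.Icc 1 k, (lam (k + 1) - lam i) * lam i) := by
  have hsq : ∀ i ∈ Finset.Icc 1 k, Real.sqrt (lam i) ^ 2 = lam i := fun i hi => by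
    rw [Finset.mem_Icc] at hi
    exact Real.sq_sqrt (h0.trans (hmono 1 i le_rfl hi.1 (by omega)))
  have h := Finset.sum_sq_mul_sum_le_of_sq_le (Finset.Icc 1 k) (fun i => Real.sqrt (lam i))
    (lam (k + 1)) (fun i _ => Real.sqrt_nonneg _) fun i hi => by
      rw [hsq i hi]
      rw [Finset.mem_Icc] at hi
      exact hmono i (k + 1) hi.1 (by omega) le_rfl
  convert h using 2 <;> exact Finset.sum_congr rfl fun i hi => by simp only [hsq i hi]
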